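/- For every homogeneous polynomial p of degree n in d variables, the Schur–Agler norm satisfies ‖p‖_{SA} ≥ |||p|||₂ ≥ |||p|||₁. -/

import Mathlib

noncomputable section
open scoped ComplexOrder
namespace WP

abbrev MvP (d : ℕ) := MvPolynomial (Fin d) ℂ

/-- The Cauchy pairing `⟨p,q⟩₂ = ∑_α a_α conj(b_α)` of coefficient vectors. -/
def pairing {d : ℕ} (p q : MvP d) : ℂ :=
  ∑ α ∈ p.support, p.coeff α * (starRingEnd ℂ) (q.coeff α)

/-- The Hardy norm `‖p‖₂`: the `ℓ²` norm of the coefficient vector. -/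
def norm2 {d : ℕ} (p : MvP d) : ℝ :=
  Real.sqrt (∑ α ∈ p.support, ‖p.coeff α‖ ^ 2)

/-- The weak product norm `‖p‖_{P_{d,k} ⊙ P_{d,l}}`. -/
def wpNorm (d k l : ℕ) (p : MvP d) : ℝ :=
  sInf {x : ℝ | ∃ (m : ℕ) (f g : Fin m → MvP d),
    (∀ j, (f j).IsHomogeneous k) ∧ (∀ j, (g j).IsHomogeneous l) ∧
    p = ∑ j, f j * g j ∧ x = ∑ j, norm2 (f j) * norm2 (g j)}

/-- The weak product norm `‖p‖_{Z_d ⊙ P_{d,k} ⊙ P_{d,l}}`. -/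
def zwpNorm (d k l : ℕ) (p : MvP d) : ℝ :=
  sInf {x : ℝ | ∃ f : Fin d → MvP d,
    (∀ i, (f i).IsHomogeneous (k + l)) ∧
    p = ∑ i, MvPolynomial.X i * f i ∧ x = ∑ i, wpNorm d k l (f i)}

/-- `|||p|||₁ = max_{0 ≤ k ≤ n} ‖p‖_{P_{d,k} ⊙ P_{d,n-k}}`. -/
def triple1 (d n : ℕ) (p : MvP d) : ℝ :=
  ⨆ k : Fin (n + 1), wpNorm d k (n - k) p

/-- `|||p|||₂ = max_{0 ≤ k ≤ n-1} ‖p‖_{Z_d ⊙ P_{d,k} ⊙ P_{d,n-k-1}}`. -/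
def triple2 (d n : ℕ) (p : MvP d) : ℝ :=
  ⨆ k : Fin n, zwpNorm d k (n - 1 - k) p

structure CTuple (d : ℕ) where
  H : Type
  [nacg : NormedAddCommGroup H]
  [ips : InnerProductSpace ℂ H]
  [cs : CompleteSpace H]
  T : Fin d → H →L[ℂ] H
  comm : ∀ i j, T i ∘L T j = T j ∘L T i
  strict : ∀ i, ‖T i‖ < 1

attribute [instance] CTuple.nacg CTuple.ips CTuple.cs

/-- `p(T)`: substitution of a commuting tuple into the polynomial `p`. -/
def evalP {d : ℕ} (p : MvP d) (X : CTuple d) : X.H →L[ℂ] X.H :=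
  ∑ α ∈ p.support, p.coeff α • (List.ofFn fun i => X.T i ^ (α i)).prod

/-- The Schur--Agler norm of a polynomial. -/
def SAnormP (d : ℕ) (p : MvP d) : ℝ :=
  ⨆ X : CTuple d, ‖evalP p X‖

open MvPolynomial

theorem norm2_nonneg {d : ℕ} (p : MvP d) : 0 ≤ norm2 p := Real.sqrt_nonneg _

theorem norm2_sq {d : ℕ} (p : MvP d) : norm2 p ^ 2 = ∑ α ∈ p.support, ‖p.coeff α‖ ^ 2 :=
  Real.sq_sqrt (Finset.sum_nonneg fun _ _ => by positivity)

theorem norm2_sq_of_subset {d : ℕ} (p : MvP d) (S : Finset (Fin d →₀ ℕ)) (h : p.support ⊆ S) :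
    norm2 p ^ 2 = ∑ α ∈ S, ‖p.coeff α‖ ^ 2 := by
  rw [norm2_sq]
  apply Finset.sum_subset h
  intro x _ hx
  simp [MvPolynomial.notMem_support_iff.mp hx]

theorem norm2_zero {d : ℕ} : norm2 (0 : MvP d) = 0 := by simp [norm2]

theorem norm2_smul {d : ℕ} (c : ℂ) (p : MvP d) : norm2 (c • p) = ‖c‖ * norm2 p := by
  have h : norm2 (c • p) ^ 2 = (‖c‖ * norm2 p) ^ 2 := by
    rw [norm2_sq_of_subset (c • p) p.support (MvPolynomial.support_smul), mul_pow, norm2_sq,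
      Finset.mul_sum]
    simp [mul_pow]
  exact (pow_left_inj₀ (norm2_nonneg _) (mul_nonneg (norm_nonneg _) (norm2_nonneg _))
    two_ne_zero).1 h

theorem norm2_X_mul {d : ℕ} (i : Fin d) (p : MvP d) : norm2 (X i * p) = norm2 p := by
  unfold norm2
  rw [MvPolynomial.support_X_mul, Finset.sum_map]
  simp [MvPolynomial.coeff_X_mul]

/-- decompositions -/
def Dec (d k l : ℕ) (p : MvP d) (x : ℝ) : Prop :=
  ∃ (m : ℕ) (f g : Fin m → MvP d),
    (∀ j, (f j).IsHomogeneous k) ∧ (∀ j, (g j).IsHomogeneous l) ∧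
    p = ∑ j, f j * g j ∧ x = ∑ j, norm2 (f j) * norm2 (g j)

theorem wpNorm_eq (d k l : ℕ) (p : MvP d) : wpNorm d k l p = sInf {x | Dec d k l p x} := rfl

theorem Dec.of_fintype {d k l : ℕ} {ι : Type*} [Fintype ι] (f g : ι → MvP d)
    (hf : ∀ j, (f j).IsHomogeneous k) (hg : ∀ j, (g j).IsHomogeneous l) :
    Dec d k l (∑ j, f j * g j) (∑ j, norm2 (f j) * norm2 (g j)) := by
  let e := (Fintype.equivFin ι).symm
  refine ⟨Fintype.card ι, f ∘ e, g ∘ e, fun j => hf _, fun j => hg _, ?_, ?_⟩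
  · exact (Equiv.sum_comp e (fun j => f j * g j)).symm
  · exact (Equiv.sum_comp e (fun j => norm2 (f j) * norm2 (g j))).symm

theorem Dec.nonneg {d k l : ℕ} {p : MvP d} {x : ℝ} (h : Dec d k l p x) : 0 ≤ x := by
  obtain ⟨m, f, g, -, -, -, rfl⟩ := h
  exact Finset.sum_nonneg fun _ _ => mul_nonneg (norm2_nonneg _) (norm2_nonneg _)

theorem Dec.add {d k l : ℕ} {p q : MvP d} {x y : ℝ} (h : Dec d k l p x) (h' : Dec d k l q y) :
    Dec d k l (p + q) (x + y) := by
  obtain ⟨m, f, g, hf, hg, rfl, rfl⟩ := h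
  obtain ⟨m', f', g', hf', hg', rfl, rfl⟩ := h'
  have := Dec.of_fintype (k := k) (l := l) (Sum.elim f f') (Sum.elim g g')
    (by rintro (j | j); exacts [hf j, hf' j]) (by rintro (j | j); exacts [hg j, hg' j])
  simpa using this

theorem isHomogeneous_smul' {d k : ℕ} {p : MvP d} (h : p.IsHomogeneous k) (c : ℂ) :
    (c • p).IsHomogeneous k := (homogeneousSubmodule (Fin d) ℂ k).smul_mem c h

theorem Dec.smul {d k l : ℕ} {p : MvP d} {x : ℝ} (h : Dec d k l p x) (c : ℂ) :
    Dec d k l (c • p) (‖c‖ * x) := by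
  obtain ⟨m, f, g, hf, hg, rfl, rfl⟩ := h
  refine ⟨m, fun j => c • f j, g, fun j => isHomogeneous_smul' (hf j) c, hg, ?_, ?_⟩
  · simp [Finset.smul_sum]
  · simp [Finset.mul_sum, norm2_smul, mul_assoc]

theorem Dec.mul {d k l : ℕ} {f g : MvP d} (hf : f.IsHomogeneous k) (hg : g.IsHomogeneous l) :
    Dec d k l (f * g) (norm2 f * norm2 g) := 
  ⟨1, fun _ => f, fun _ => g, fun _ => hf, fun _ => hg, by simp, by simp⟩

theorem Dec.zero {d k l : ℕ} : Dec d k l 0 0 := 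
  ⟨0, fun _ => 0, fun _ => 0, by simp, by simp, by simp, by simp⟩

theorem Dec.X_mul_right {d k l : ℕ} {p : MvP d} {x : ℝ} (h : Dec d k l p x) (i : Fin d) :
    Dec d k (l + 1) (X i * p) x := by
  obtain ⟨m, f, g, hf, hg, rfl, rfl⟩ := h
  refine ⟨m, f, fun j => X i * g j, hf, fun j => ?_, ?_, ?_⟩
  · rw [add_comm]; exact (isHomogeneous_X ℂ i).mul (hg j)
  · rw [Finset.mul_sum]; exact Finset.sum_congr rfl fun j _ => by ring
  · simp [norm2_X_mul]

theorem Dec.X_mul_left {d k l : ℕ} {p : MvP d} {x : ℝ} (h : Dec d k l p x) (i : Fin d) :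
    Dec d (k + 1) l (X i * p) x := by
  obtain ⟨m, f, g, hf, hg, rfl, rfl⟩ := h
  refine ⟨m, fun j => X i * f j, g, fun j => ?_, hg, ?_, ?_⟩
  · rw [add_comm]; exact (isHomogeneous_X ℂ i).mul (hf j)
  · rw [Finset.mul_sum]; exact Finset.sum_congr rfl fun j _ => by ring
  · simp [norm2_X_mul]

theorem Dec.exists {d k l : ℕ} {p : MvP d} (hp : p.IsHomogeneous (k + l)) :
    ∃ x, Dec d k l p x := by
  have key : ∀ S : Finset (Fin d →₀ ℕ), S ⊆ p.support →
      ∃ x, Dec d k l (∑ α ∈ S, monomial α (p.coeff α)) x := by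
    intro S
    induction S using Finset.induction_on with
    | empty => intro _; exact ⟨0, by simpa using Dec.zero⟩
    | insert a s ha ih =>
      intro hs
      rw [Finset.insert_subset_iff] at hs
      obtain ⟨x, hx⟩ := ih hs.2
      have hdeg : a.degree = k + l := by
        by_contra hne
        exact (MvPolynomial.mem_support_iff.mp hs.1) (hp.coeff_eq_zero hne)
      obtain ⟨b, hb, hbk⟩ := Finsupp.exists_le_degree_eq a k (by omega)
      obtain ⟨c, rfl⟩ := exists_add_of_le hb
      have hc : c.degree = l := by rw [map_add] at hdeg; omega
      have h1 := Dec.mul (isHomogeneous_monomial (p.coeff (b + c)) hbk)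
        (isHomogeneous_monomial (1 : ℂ) hc)
      rw [MvPolynomial.monomial_mul, mul_one] at h1
      exact ⟨_, by rw [Finset.sum_insert ha]; exact h1.add hx⟩
  obtain ⟨x, hx⟩ := key p.support subset_rfl
  rw [← MvPolynomial.as_sum p] at hx
  exact ⟨x, hx⟩

theorem Dec.bdd {d k l : ℕ} (p : MvP d) : BddBelow {x | Dec d k l p x} :=
  ⟨0, fun _ h => h.nonneg⟩

theorem wpNorm_le {d k l : ℕ} {p : MvP d} {x : ℝ} (h : Dec d k l p x) : wpNorm d k l p ≤ x :=
  csInf_le (Dec.bdd p) h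

theorem wpNorm_nonneg (d k l : ℕ) (p : MvP d) : 0 ≤ wpNorm d k l p :=
  Real.sInf_nonneg fun _ h => Dec.nonneg h

theorem wpNorm_zero (d k l : ℕ) : wpNorm d k l 0 = 0 :=
  le_antisymm (wpNorm_le Dec.zero) (wpNorm_nonneg _ _ _ _)

theorem exists_dec_lt {d k l : ℕ} {p : MvP d} (hp : p.IsHomogeneous (k + l)) {ε : ℝ} (hε : 0 < ε) :
    ∃ x, Dec d k l p x ∧ x < wpNorm d k l p + ε :=
  Real.lt_sInf_add_pos (Dec.exists hp) hε

theorem wpNorm_add {d k l : ℕ} {p q : MvP d} (hp : p.IsHomogeneous (k + l))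
    (hq : q.IsHomogeneous (k + l)) :
    wpNorm d k l (p + q) ≤ wpNorm d k l p + wpNorm d k l q := by
  apply le_of_forall_pos_le_add
  intro ε hε
  obtain ⟨x, hx, hx'⟩ := exists_dec_lt hp (half_pos hε)
  obtain ⟨y, hy, hy'⟩ := exists_dec_lt hq (half_pos hε)
  have := wpNorm_le (hx.add hy)
  linarith

theorem wpNorm_smul {d k l : ℕ} {p : MvP d} (hp : p.IsHomogeneous (k + l)) (c : ℂ) :
    wpNorm d k l (c • p) ≤ ‖c‖ * wpNorm d k l p := by
  rw [wpNorm_eq _ _ _ p, ← smul_eq_mul, ← Real.sInf_smul_of_nonneg (norm_nonneg c)]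
  apply le_csInf (Set.Nonempty.smul_set (Dec.exists hp))
  rintro _ ⟨x, hx, rfl⟩
  exact wpNorm_le (Dec.smul hx c)

theorem wpNorm_sum {d k l : ℕ} {ι : Type*} (s : Finset ι) (f : ι → MvP d)
    (hf : ∀ i, (f i).IsHomogeneous (k + l)) :
    wpNorm d k l (∑ i ∈ s, f i) ≤ ∑ i ∈ s, wpNorm d k l (f i) := by
  classical
  induction s using Finset.induction_on with
  | empty => simp [wpNorm_zero]
  | insert a s ha ih =>
    rw [Finset.sum_insert ha, Finset.sum_insert ha]
    have := wpNorm_add (hf a) (IsHomogeneous.sum s f _ fun i _ => hf i)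
    linarith

theorem wpNorm_X_mul_right {d k l : ℕ} {p : MvP d} (hp : p.IsHomogeneous (k + l)) (i : Fin d) :
    wpNorm d k (l + 1) (X i * p) ≤ wpNorm d k l p :=
  le_csInf (Dec.exists hp) fun _ hx => wpNorm_le (Dec.X_mul_right hx i)

theorem wpNorm_X_mul_left {d k l : ℕ} {p : MvP d} (hp : p.IsHomogeneous (k + l)) (i : Fin d) :
    wpNorm d (k + 1) l (X i * p) ≤ wpNorm d k l p :=
  le_csInf (Dec.exists hp) fun _ hx => wpNorm_le (Dec.X_mul_left hx i)

/-- decompositions for the second norm -/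
def ZDec (d k l : ℕ) (p : MvP d) (x : ℝ) : Prop :=
  ∃ f : Fin d → MvP d,
    (∀ i, (f i).IsHomogeneous (k + l)) ∧
    p = ∑ i, MvPolynomial.X i * f i ∧ x = ∑ i, wpNorm d k l (f i)

theorem zwpNorm_eq (d k l : ℕ) (p : MvP d) : zwpNorm d k l p = sInf {x | ZDec d k l p x} := rfl

theorem ZDec.nonneg {d k l : ℕ} {p : MvP d} {x : ℝ} (h : ZDec d k l p x) : 0 ≤ x := by
  obtain ⟨f, -, -, rfl⟩ := h
  exact Finset.sum_nonneg fun _ _ => wpNorm_nonneg _ _ _ _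

theorem ZDec.bdd {d k l : ℕ} (p : MvP d) : BddBelow {x | ZDec d k l p x} :=
  ⟨0, fun _ h => h.nonneg⟩

theorem zwpNorm_nonneg (d k l : ℕ) (p : MvP d) : 0 ≤ zwpNorm d k l p :=
  Real.sInf_nonneg fun _ h => ZDec.nonneg h

theorem zwpNorm_le {d k l : ℕ} {p : MvP d} {x : ℝ} (h : ZDec d k l p x) : zwpNorm d k l p ≤ x :=
  csInf_le (ZDec.bdd p) h

theorem zwpNorm_le_of {d k l : ℕ} (f : Fin d → MvP d) (hf : ∀ i, (f i).IsHomogeneous (k + l)) :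
    zwpNorm d k l (∑ i, X i * f i) ≤ ∑ i, wpNorm d k l (f i) :=
  zwpNorm_le ⟨f, hf, rfl, rfl⟩

theorem ZDec.exists {d k l : ℕ} {p : MvP d} (hp : p.IsHomogeneous (k + l + 1)) :
    ∃ x, ZDec d k l p x := by
  suffices h : ∃ f : Fin d → MvP d, (∀ i, (f i).IsHomogeneous (k + l)) ∧ p = ∑ i, X i * f i by
    obtain ⟨f, hf, h⟩ := h
    exact ⟨_, f, hf, h, rfl⟩
  have key : ∀ S : Finset (Fin d →₀ ℕ), S ⊆ p.support →
      ∃ f : Fin d → MvP d, (∀ i, (f i).IsHomogeneous (k + l)) ∧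
        (∑ α ∈ S, monomial α (p.coeff α)) = ∑ i, X i * f i := by
    intro S
    induction S using Finset.induction_on with
    | empty => intro _; exact ⟨0, fun i => isHomogeneous_zero _ _ _, by simp⟩
    | insert a s ha ih =>
      intro hs
      rw [Finset.insert_subset_iff] at hs
      obtain ⟨f, hf, hx⟩ := ih hs.2
      have hdeg : a.degree = k + l + 1 := by
        by_contra hne
        exact (MvPolynomial.mem_support_iff.mp hs.1) (hp.coeff_eq_zero hne)
      have ha0 : a ≠ 0 := by rintro rfl; simp at hdeg
      obtain ⟨i, hi⟩ := Finsupp.ne_iff.mp ha0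
      have hle : Finsupp.single i 1 ≤ a := by
        rw [Finsupp.single_le_iff]; simpa [Nat.one_le_iff_ne_zero] using hi
      obtain ⟨c, rfl⟩ := exists_add_of_le hle
      have hc : c.degree = k + l := by rw [map_add, Finsupp.degree_single] at hdeg; omega
      refine ⟨f + Pi.single i (monomial c (p.coeff (Finsupp.single i 1 + c))), ?_, ?_⟩
      · intro j
        refine (hf j).add ?_
        rcases eq_or_ne j i with rfl | hji
        · rw [Pi.single_eq_same]; exact isHomogeneous_monomial _ hc
        · rw [Pi.single_eq_of_ne hji]; exact isHomogeneous_zero _ _ _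
      · rw [Finset.sum_insert ha, hx]
        simp only [Pi.add_apply, mul_add, Finset.sum_add_distrib]
        rw [add_comm, add_right_inj, Finset.sum_eq_single i]
        · rw [Pi.single_eq_same, X, monomial_mul, one_mul]
        · intro j _ hji
          rw [Pi.single_eq_of_ne hji, mul_zero]
        · simp
  obtain ⟨x, hx⟩ := key p.support subset_rfl
  rw [← MvPolynomial.as_sum p] at hx
  exact ⟨x, hx⟩

theorem zwpNorm_add {d k l : ℕ} {p q : MvP d} (hp : p.IsHomogeneous (k + l + 1))
    (hq : q.IsHomogeneous (k + l + 1)) :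
    zwpNorm d k l (p + q) ≤ zwpNorm d k l p + zwpNorm d k l q := by
  apply le_of_forall_pos_le_add
  intro ε hε
  obtain ⟨x, ⟨f, hf, rfl, rfl⟩, hx'⟩ := Real.lt_sInf_add_pos (ZDec.exists hp) (half_pos hε)
  obtain ⟨y, ⟨g, hg, rfl, rfl⟩, hy'⟩ := Real.lt_sInf_add_pos (ZDec.exists hq) (half_pos hε)
  change _ < zwpNorm d k l _ + _ at hx' hy'
  have h1 := zwpNorm_le_of (fun i => f i + g i) (fun i => (hf i).add (hg i))
  have h2 : ∑ i, wpNorm d k l (f i + g i) ≤ ∑ i, (wpNorm d k l (f i) + wpNorm d k l (g i)) :=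
    Finset.sum_le_sum fun i _ => wpNorm_add (hf i) (hg i)
  simp only [mul_add, Finset.sum_add_distrib] at h1 h2
  linarith

theorem zwpNorm_smul {d k l : ℕ} {p : MvP d} (hp : p.IsHomogeneous (k + l + 1)) (c : ℂ) :
    zwpNorm d k l (c • p) ≤ ‖c‖ * zwpNorm d k l p := by
  rw [zwpNorm_eq _ _ _ p, ← smul_eq_mul, ← Real.sInf_smul_of_nonneg (norm_nonneg c)]
  apply le_csInf (Set.Nonempty.smul_set (ZDec.exists hp))
  rintro _ ⟨x, ⟨f, hf, rfl, rfl⟩, rfl⟩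
  have h1 := zwpNorm_le_of (fun i => c • f i) (fun i => isHomogeneous_smul' (hf i) c)
  have h2 : ∑ i, wpNorm d k l (c • f i) ≤ ∑ i, (‖c‖ * wpNorm d k l (f i)) :=
    Finset.sum_le_sum fun i _ => wpNorm_smul (hf i) c
  simp only [mul_smul_comm, ← Finset.smul_sum, ← Finset.mul_sum] at h1 h2
  exact h1.trans h2

theorem zwpNorm_X_mul_mul {d k l : ℕ} (i : Fin d) {f g : MvP d} (hf : f.IsHomogeneous k)
    (hg : g.IsHomogeneous l) : zwpNorm d k l (X i * (f * g)) ≤ norm2 f * norm2 g := by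
  have h1 := zwpNorm_le_of (k := k) (l := l) (Pi.single i (f * g)) (by
    intro j
    rcases eq_or_ne j i with rfl | hji
    · rw [Pi.single_eq_same]; exact hf.mul hg
    · rw [Pi.single_eq_of_ne hji]; exact isHomogeneous_zero _ _ _)
  rw [Finset.sum_eq_single i (by intro j _ hji; rw [Pi.single_eq_of_ne hji, mul_zero]) (by simp),
    Finset.sum_eq_single i (by intro j _ hji; rw [Pi.single_eq_of_ne hji, wpNorm_zero]) (by simp),
    Pi.single_eq_same] at h1
  exact h1.trans (wpNorm_le (Dec.mul hf hg))

theorem wpNorm_le_zwpNorm_right {d k l : ℕ} {p : MvP d} (hp : p.IsHomogeneous (k + l + 1)) :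
    wpNorm d k (l + 1) p ≤ zwpNorm d k l p := by
  refine le_csInf (ZDec.exists hp) ?_
  rintro x ⟨f, hf, rfl, rfl⟩
  refine (wpNorm_sum _ _ fun i => ?_).trans (Finset.sum_le_sum fun i _ =>
    wpNorm_X_mul_right (hf i) i)
  have := (isHomogeneous_X ℂ i).mul (hf i)
  rwa [show 1 + (k + l) = k + (l + 1) by ring] at this

theorem wpNorm_le_zwpNorm_left {d k l : ℕ} {p : MvP d} (hp : p.IsHomogeneous (k + l + 1)) :
    wpNorm d (k + 1) l p ≤ zwpNorm d k l p := by
  refine le_csInf (ZDec.exists hp) ?_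
  rintro x ⟨f, hf, rfl, rfl⟩
  refine (wpNorm_sum _ _ fun i => ?_).trans (Finset.sum_le_sum fun i _ =>
    wpNorm_X_mul_left (hf i) i)
  have := (isHomogeneous_X ℂ i).mul (hf i)
  rwa [show 1 + (k + l) = (k + 1) + l by ring] at this

theorem triple1_le_triple2 {d n : ℕ} (hn : 1 ≤ n) {p : MvP d} (hp : p.IsHomogeneous n) :
    triple1 d n p ≤ triple2 d n p := by
  have hb : BddAbove (Set.range fun k : Fin n => zwpNorm d k (n - 1 - k) p) :=
    (Set.finite_range _).bddAbove
  refine ciSup_le fun k => ?_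
  obtain ⟨k, hk⟩ := k
  rcases Nat.lt_or_ge k n with h | h
  · obtain ⟨l, rfl⟩ : ∃ l, n = k + l + 1 := ⟨n - 1 - k, by omega⟩
    refine le_trans ?_ (le_ciSup hb ⟨k, h⟩)
    have := wpNorm_le_zwpNorm_right hp
    simpa [show k + l + 1 - k = l + 1 by omega, show k + l - k = l by omega] using this
  · obtain rfl : k = n := by omega
    obtain ⟨k, rfl⟩ : ∃ j, k = j + 1 := ⟨k - 1, by omega⟩
    refine le_trans ?_ (le_ciSup hb ⟨k, by omega⟩)
    have := wpNorm_le_zwpNorm_left (k := k) (l := 0) hp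
    simpa using this

theorem hahn {E : Type*} [AddCommGroup E] [Module ℂ E] (N : Seminorm ℂ E) (p : E) :
    ∃ φ : E →ₗ[ℂ] ℂ, N p ≤ ‖φ p‖ ∧ ∀ q, ‖φ q‖ ≤ N q := by
  by_cases h0 : p = 0
  · exact ⟨0, by simp [h0], by simp⟩
  · let e := LinearEquiv.toSpanNonzeroSingleton ℂ E p h0
    have he : ∀ c, (e c : E) = c • p := fun c => rfl
    obtain ⟨g, hg, hg'⟩ := Module.Dual.exists_extension_of_le_seminorm
      (Submodule.span ℂ {p}) ((N p : ℂ) • e.symm.toLinearMap) (p := N) (by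
        intro x
        obtain ⟨c, rfl⟩ := e.surjective x
        rw [he, map_smul_eq_mul]
        simp only [LinearMap.smul_apply, LinearEquiv.coe_coe, LinearEquiv.symm_apply_apply,
          smul_eq_mul, norm_mul, Complex.norm_real, Real.norm_eq_abs,
          abs_of_nonneg (apply_nonneg N p)]
        rw [mul_comm])
    refine ⟨g, ?_, hg'⟩
    have := hg (e 1)
    rw [he, one_smul] at this
    rw [this]
    simp only [LinearMap.smul_apply, LinearEquiv.coe_coe, LinearEquiv.symm_apply_apply,
      smul_eq_mul, norm_mul, Complex.norm_real, Real.norm_eq_abs,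
      abs_of_nonneg (apply_nonneg N p)]
    simp

/-- Dual functional. -/
theorem exists_dual {d k l : ℕ} {p : MvP d} (hp : p.IsHomogeneous (k + l + 1)) :
    ∃ φ : MvP d →ₗ[ℂ] ℂ, (∀ (m : ℕ) (q : MvP d), q.IsHomogeneous m → m ≠ k + l + 1 → φ q = 0) ∧
      (∀ (i : Fin d) (f g : MvP d), f.IsHomogeneous k → g.IsHomogeneous l →
        ‖φ (X i * (f * g))‖ ≤ norm2 f * norm2 g) ∧ zwpNorm d k l p ≤ ‖φ p‖ := by
  have hH := fun q : MvP d => homogeneousComponent_isHomogeneous (k + l + 1) q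
  let N : Seminorm ℂ (MvP d) := Seminorm.ofSMulLE
    (fun q => zwpNorm d k l (homogeneousComponent (k + l + 1) q))
    (by
      have := zwpNorm_smul (k := k) (l := l) (p := 0) (isHomogeneous_zero (Fin d) ℂ _) 0
      simp only [norm_zero, zero_mul, smul_zero] at this
      simpa using le_antisymm this (zwpNorm_nonneg _ _ _ _))
    (fun x y => by rw [map_add]; exact zwpNorm_add (hH x) (hH y))
    (fun c x => by rw [map_smul]; exact zwpNorm_smul (hH x) c)
  have hN : ∀ q, N q = zwpNorm d k l (homogeneousComponent (k + l + 1) q) := fun q => rfl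
  have hN' : ∀ q : MvP d, q.IsHomogeneous (k + l + 1) → N q = zwpNorm d k l q := fun q hq => by
    rw [hN, homogeneousComponent_eq_self hq]
  obtain ⟨φ, hφ, hle⟩ : ∃ φ : MvP d →ₗ[ℂ] ℂ, N p ≤ ‖φ p‖ ∧ ∀ q, ‖φ q‖ ≤ N q := by
    exact hahn N p
  refine ⟨φ, fun m q hq hm => ?_, fun i f g hf hg => ?_, ?_⟩
  · have := hle q
    have h0 : N q = 0 := by
      rw [hN, homogeneousComponent_of_mem hq, if_neg hm.symm, ← map_zero (homogeneousComponent (k+l+1)), ← hN]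
      simp
    rw [h0] at this
    exact norm_le_zero_iff.mp this
  · refine (hle _).trans ?_
    rw [hN']
    · exact zwpNorm_X_mul_mul i hf hg
    · rw [add_comm]; exact (isHomogeneous_X ℂ i).mul (hf.mul hg)
  · rw [← hN' p hp]; exact hφ

/-- Multi-indices of degree at most `m`. -/
abbrev Idx (d m : ℕ) := {α : Fin d →₀ ℕ // α.degree ≤ m}

instance instFintypeIdx (d m : ℕ) : Fintype (Idx d m) :=
  (Finsupp.finite_of_degree_le (σ := Fin d) m).fintype

/-- The model space. -/
abbrev HS (d k l : ℕ) := EuclideanSpace ℂ (Idx d k ⊕ Idx d l)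

/-- Polynomial with given coefficients. -/
def Fp (d m : ℕ) : (Idx d m → ℂ) →ₗ[ℂ] MvP d where
  toFun w := ∑ α, monomial α.1 (w α)
  map_add' x y := by simp [Finset.sum_add_distrib]
  map_smul' c x := by simp [Finset.smul_sum, smul_monomial]

theorem Fp_apply {d m : ℕ} (w : Idx d m → ℂ) : Fp d m w = ∑ α, monomial α.1 (w α) := rfl

theorem coeff_Fp {d m : ℕ} (w : Idx d m → ℂ) (α : Idx d m) : coeff α.1 (Fp d m w) = w α := by
  classical
  rw [Fp_apply, coeff_sum, Finset.sum_eq_single α]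
  · simp
  · intro b _ hb
    rw [coeff_monomial, if_neg fun h => hb (Subtype.ext h)]
  · simp

theorem coeff_Fp_of_gt {d m : ℕ} (w : Idx d m → ℂ) (α : Fin d →₀ ℕ) (h : m < α.degree) :
    coeff α (Fp d m w) = 0 := by
  classical
  rw [Fp_apply, coeff_sum]
  apply Finset.sum_eq_zero
  intro b _
  rw [coeff_monomial, if_neg]
  rintro rfl
  exact absurd b.2 (by omega)

theorem sum_coeff_le {d : ℕ} {ι : Type*} [Fintype ι] (P : MvP d) (e : ι → (Fin d →₀ ℕ))
    (he : Function.Injective e) : ∑ j, ‖coeff (e j) P‖ ^ 2 ≤ norm2 P ^ 2 := by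
  classical
  rw [norm2_sq_of_subset P (P.support ∪ Finset.univ.map ⟨e, he⟩) Finset.subset_union_left]
  have : ∑ j, ‖coeff (e j) P‖ ^ 2 = ∑ α ∈ Finset.univ.map ⟨e, he⟩, ‖coeff α P‖ ^ 2 := by
    rw [Finset.sum_map]; rfl
  rw [this]
  exact Finset.sum_le_sum_of_subset_of_nonneg Finset.subset_union_right
    fun _ _ _ => by positivity

theorem norm2_Fp {d m : ℕ} (w : Idx d m → ℂ) : norm2 (Fp d m w) ^ 2 = ∑ α, ‖w α‖ ^ 2 := by
  classical
  rw [norm2_sq_of_subset _ ((Finset.univ : Finset (Idx d m)).map (Function.Embedding.subtype _)), Finset.sum_map]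
  · exact Finset.sum_congr rfl fun α _ => by
      rw [Function.Embedding.subtype_apply, coeff_Fp]
  · intro α hα
    rw [mem_support_iff] at hα
    have : α.degree ≤ m := by
      by_contra h
      exact hα (coeff_Fp_of_gt w α (by omega))
    simp [this]

theorem norm2_split {d : ℕ} (k : ℕ) (P : MvP d) :
    norm2 (P - homogeneousComponent k P) ^ 2 + norm2 (homogeneousComponent k P) ^ 2
      = norm2 P ^ 2 := by
  classical
  rw [norm2_sq_of_subset (P - homogeneousComponent k P) P.support,
    norm2_sq_of_subset (homogeneousComponent k P) P.support, norm2_sq, ← Finset.sum_add_distrib]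
  · refine Finset.sum_congr rfl fun α _ => ?_
    rw [coeff_sub, coeff_homogeneousComponent]
    split_ifs <;> simp
  · intro α h
    rw [mem_support_iff] at h ⊢
    intro h0
    rw [coeff_homogeneousComponent, h0] at h
    simp at h
  · intro α h
    rw [mem_support_iff] at h ⊢
    intro h0
    rw [coeff_sub, coeff_homogeneousComponent, h0] at h
    simp at h

theorem coeff_X_mul_congr {d k : ℕ} {P Q : MvP d}
    (h : ∀ α : Fin d →₀ ℕ, α.degree < k → coeff α P = coeff α Q) (i : Fin d) (α : Fin d →₀ ℕ)
    (hα : α.degree ≤ k) : coeff α (X i * P) = coeff α (X i * Q) := by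
  classical
  rw [coeff_X_mul', coeff_X_mul']
  split_ifs with hi
  · have hle : Finsupp.single i 1 ≤ α := by
      rw [Finsupp.single_le_iff]
      exact Nat.one_le_iff_ne_zero.mpr (Finsupp.mem_support_iff.mp hi)
    obtain ⟨c, rfl⟩ := exists_add_of_le hle
    rw [add_tsub_cancel_left]
    apply h
    rw [map_add, Finsupp.degree_single] at hα
    omega
  · rfl

theorem hc_congr {d k : ℕ} {P Q : MvP d}
    (h : ∀ α : Fin d →₀ ℕ, α.degree ≤ k → coeff α P = coeff α Q) :
    homogeneousComponent k P = homogeneousComponent k Q := by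
  ext α
  rw [coeff_homogeneousComponent, coeff_homogeneousComponent]
  split_ifs with hα
  · exact h α hα.le
  · rfl

theorem gen_T_pow {d : ℕ} (Y : CTuple d) (J : MvP d →ₗ[ℂ] Y.H) (r : ℂ)
    (hJ : ∀ i q, Y.T i (J q) = J ((C r * X i) * q)) (i : Fin d) (m : ℕ) (q : MvP d) :
    (Y.T i ^ m) (J q) = J ((C r * X i) ^ m * q) := by
  induction m generalizing q with
  | zero => simp
  | succ m ih =>
    rw [pow_succ, mul_apply_eq_comp, hJ, ih]
    congr 1; ring

theorem gen_T_prod {d : ℕ} (Y : CTuple d) (J : MvP d →ₗ[ℂ] Y.H) (r : ℂ)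
    (hJ : ∀ i q, Y.T i (J q) = J ((C r * X i) * q)) (α : Fin d →₀ ℕ) (L : List (Fin d))
    (q : MvP d) :
    ((L.map fun i => Y.T i ^ (α i)).prod) (J q) =
      J ((L.map fun i => (C r * X i) ^ (α i)).prod * q) := by
  induction L generalizing q with
  | nil => simp
  | cons a L ih =>
    rw [List.map_cons, List.prod_cons, mul_apply_eq_comp, ih, gen_T_pow Y J r hJ,
      List.map_cons, List.prod_cons, mul_assoc]

theorem prod_CX {d : ℕ} (r : ℂ) (α : Fin d →₀ ℕ) :
    ((List.finRange d).map fun i => (C r * X i : MvP d) ^ (α i)).prod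
      = monomial α (r ^ α.degree) := by
  rw [← List.ofFn_eq_map, List.prod_ofFn]
  simp only [mul_pow, Finset.prod_mul_distrib]
  rw [Finset.prod_pow_eq_pow_sum, ← Finsupp.degree_eq_sum, monomial_eq, C_pow,
    Finsupp.prod_fintype _ _ (by simp)]

theorem gen_evalP {d : ℕ} (Y : CTuple d) (J : MvP d →ₗ[ℂ] Y.H) (r : ℂ)
    (hJ : ∀ i q, Y.T i (J q) = J ((C r * X i) * q)) {n : ℕ} (p : MvP d) (hp : p.IsHomogeneous n) :
    evalP p Y (J 1) = r ^ n • J p := by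
  have : (∑ α ∈ p.support, r ^ n • J (monomial α (p.coeff α))) = r ^ n • J p := by
    rw [← Finset.smul_sum, ← map_sum, ← as_sum]
  rw [← this]
  unfold evalP
  rw [_root_.sum_apply]
  refine Finset.sum_congr rfl fun α hα => ?_
  have hdeg : α.degree = n := by
    by_contra hne
    exact (MvPolynomial.mem_support_iff.mp hα) (hp.coeff_eq_zero hne)
  rw [List.ofFn_eq_map, _root_.smul_apply, gen_T_prod Y J r hJ,
    mul_one, prod_CX, hdeg, ← map_smul J, ← map_smul J, smul_monomial, smul_monomial,
    smul_eq_mul, smul_eq_mul, mul_comm]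

theorem norm_one_le' {d : ℕ} (Y : CTuple d) : ‖(1 : Y.H →L[ℂ] Y.H)‖ ≤ 1 :=
  ContinuousLinearMap.norm_id_le

theorem gen_bound {d : ℕ} (Y : CTuple d) (J : MvP d →ₗ[ℂ] Y.H) (r : ℝ) (hr0 : 0 ≤ r)
    (hJ : ∀ i q, Y.T i (J q) = J ((C (r : ℂ) * X i) * q)) (hJ1 : ‖J 1‖ ≤ 1)
    {n : ℕ} (p : MvP d) (hp : p.IsHomogeneous n) :
    r ^ n * ‖J p‖ ≤ ‖evalP p Y‖ := by
  have e1 := gen_evalP Y J r hJ p hp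
  have e2 := (evalP p Y).le_opNorm (J 1)
  rw [e1, norm_smul, norm_pow, Complex.norm_real, Real.norm_of_nonneg hr0] at e2
  exact e2.trans (mul_le_of_le_one_right (norm_nonneg _) hJ1)

section model

variable {d k l : ℕ} (φ : MvP d →ₗ[ℂ] ℂ)
  (h0 : ∀ (m : ℕ) (q : MvP d), q.IsHomogeneous m → m ≠ k + l + 1 → φ q = 0)
  (h1 : ∀ (i : Fin d) (f g : MvP d), f.IsHomogeneous k → g.IsHomogeneous l →
        ‖φ (X i * (f * g))‖ ≤ norm2 f * norm2 g)

/-- The `P`-part. -/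
def FF (v : HS d k l) : MvP d := Fp d k fun α => v (Sum.inl α)
/-- The dual part. -/
def GG (v : HS d k l) : MvP d := Fp d l fun α => v (Sum.inr α)

theorem FF_add (v w : HS d k l) : FF (v + w) = FF v + FF w := by
  unfold FF; rw [← map_add]; rfl
theorem GG_add (v w : HS d k l) : GG (v + w) = GG v + GG w := by
  unfold GG; rw [← map_add]; rfl
theorem FF_smul (c : ℂ) (v : HS d k l) : FF (c • v) = c • FF v := by
  unfold FF; rw [← map_smul]; rfl
theorem GG_smul (c : ℂ) (v : HS d k l) : GG (c • v) = c • GG v := by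
  unfold GG; rw [← map_smul]; rfl

/-- The operators. -/
def TT (i : Fin d) : HS d k l →ₗ[ℂ] HS d k l where
  toFun v := WithLp.toLp 2 (Sum.elim (fun α => coeff α.1 (X i * FF v))
    (fun β => coeff (β.1 + Finsupp.single i 1) (GG v) +
      if β.1.degree = l then φ (monomial β.1 1 * (X i * FF v)) else 0))
  map_add' v w := by
    ext (α | β)
    · simp [FF_add, mul_add]
    · simp only [FF_add, GG_add, mul_add, Sum.elim_inr, PiLp.add_apply, coeff_add, map_add]
      split_ifs <;> ring
  map_smul' c v := by
    ext (α | β)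
    · simp [FF_smul]
    · simp only [FF_smul, GG_smul, mul_smul_comm, Sum.elim_inr, PiLp.smul_apply, coeff_smul,
        map_smul, RingHom.id_apply, smul_eq_mul]
      split_ifs <;> ring

theorem TT_inl (i : Fin d) (v : HS d k l) (α : Idx d k) :
    TT φ i v (Sum.inl α) = coeff α.1 (X i * FF v) := rfl

theorem TT_inr (i : Fin d) (v : HS d k l) (β : Idx d l) :
    TT φ i v (Sum.inr β) = coeff (β.1 + Finsupp.single i 1) (GG v) +
      if β.1.degree = l then φ (monomial β.1 1 * (X i * FF v)) else 0 := rfl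

theorem coeff_FF_TT (i : Fin d) (v : HS d k l) (α : Fin d →₀ ℕ) (h : α.degree ≤ k) :
    coeff α (FF (TT φ i v)) = coeff α (X i * FF v) := coeff_Fp _ ⟨α, h⟩

theorem coeff_GG_TT (i : Fin d) (v : HS d k l) (β : Fin d →₀ ℕ) (h : β.degree ≤ l) :
    coeff β (GG (TT φ i v)) = coeff (β + Finsupp.single i 1) (GG v) +
      if β.degree = l then φ (monomial β 1 * (X i * FF v)) else 0 := coeff_Fp _ ⟨β, h⟩

theorem coeff_GG_of_gt (v : HS d k l) (β : Fin d →₀ ℕ) (h : l < β.degree) :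
    coeff β (GG v) = 0 := coeff_Fp_of_gt _ β h

include h0 in
theorem phi_hc (β : Fin d →₀ ℕ) (hβ : β.degree = l) (i : Fin d) (P : MvP d) :
    φ (monomial β 1 * (X i * P)) = φ (monomial β 1 * (X i * homogeneousComponent k P)) := by
  induction P using MvPolynomial.induction_on' with
  | monomial α c =>
    rw [homogeneousComponent_of_mem (isHomogeneous_monomial c rfl)]
    split_ifs with h
    · rfl
    · rw [mul_zero, mul_zero, map_zero]
      refine h0 _ _ ((isHomogeneous_monomial _ hβ).mul
        ((isHomogeneous_X ℂ i).mul (isHomogeneous_monomial c rfl))) ?_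
      omega
  | add p q hp hq => simp only [mul_add, map_add, hp, hq]

include h0 in
theorem phi_congr (β : Fin d →₀ ℕ) (hβ : β.degree = l) (i : Fin d) {P Q : MvP d}
    (h : ∀ α : Fin d →₀ ℕ, α.degree ≤ k → coeff α P = coeff α Q) :
    φ (monomial β 1 * (X i * P)) = φ (monomial β 1 * (X i * Q)) := by
  rw [phi_hc φ h0 β hβ, phi_hc φ h0 β hβ i Q, hc_congr h]

theorem monomial_add_single' (β : Fin d →₀ ℕ) (i : Fin d) (P : MvP d) :
    monomial (β + Finsupp.single i 1) (1 : ℂ) * P = monomial β 1 * (X i * P) := by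
  rw [X, ← mul_assoc, monomial_mul, one_mul]

include h0 in
theorem TT_comm_inr (i j : Fin d) (v : HS d k l) (β : Idx d l) :
    TT φ i (TT φ j v) (Sum.inr β) = coeff (β.1 + Finsupp.single i 1 + Finsupp.single j 1) (GG v) +
      if β.1.degree = l ∨ β.1.degree + 1 = l then φ (monomial β.1 1 * (X i * (X j * FF v)))
        else 0 := by
  obtain ⟨β, hβ⟩ := β
  have hd : (β + Finsupp.single i 1).degree = β.degree + 1 := by
    rw [map_add, Finsupp.degree_single]
  have hd' : (β + Finsupp.single i 1 + Finsupp.single j 1).degree = β.degree + 1 + 1 := by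
    rw [map_add, hd, Finsupp.degree_single]
  rw [TT_inr]
  dsimp only
  rcases eq_or_lt_of_le hβ with h | h
  · rw [coeff_GG_of_gt _ _ (by omega), coeff_GG_of_gt _ _ (by omega)]
    simp only [h, if_true, true_or]
    rw [phi_congr φ h0 β h i (coeff_FF_TT φ j v)]
  · rw [coeff_GG_TT _ _ _ _ (by omega), hd, monomial_add_single']
    simp only [h.ne, if_false, false_or, add_zero]

include h0 in
theorem TT_comm (i j : Fin d) (v : HS d k l) : TT φ i (TT φ j v) = TT φ j (TT φ i v) := by
  ext (α | β)
  · rw [TT_inl, TT_inl, coeff_X_mul_congr (fun a ha => coeff_FF_TT φ j v a ha.le) i α.1 α.2,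
      coeff_X_mul_congr (fun a ha => coeff_FF_TT φ i v a ha.le) j α.1 α.2]
    congr 1; ring
  · rw [TT_comm_inr φ h0, TT_comm_inr φ h0, add_right_comm, show
      (X i * (X j * FF v) : MvP d) = X j * (X i * FF v) by ring]

include h1 in
theorem gamma_bound (i : Fin d) (P : MvP d) (hP : P.IsHomogeneous k) :
    ∑ β : Idx d l, ‖if β.1.degree = l then φ (monomial β.1 1 * (X i * P)) else 0‖ ^ 2
      ≤ norm2 P ^ 2 := by
  set c : Idx d l → ℂ := fun β => if β.1.degree = l then φ (monomial β.1 1 * (X i * P)) else 0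
    with hc
  set S : ℝ := ∑ β, ‖c β‖ ^ 2 with hS
  change S ≤ _
  have hS0 : 0 ≤ S := Finset.sum_nonneg fun _ _ => by positivity
  let g : MvP d := Fp d l fun β => (starRingEnd ℂ) (c β)
  have hg2 : norm2 g ^ 2 = S := by
    simp only [g, norm2_Fp, hS, RCLike.norm_conj]
  have hg : g.IsHomogeneous l := by
    apply IsHomogeneous.sum
    intro β _
    by_cases h : β.1.degree = l
    · exact isHomogeneous_monomial _ h
    · simp only [hc, if_neg h, map_zero]
      exact isHomogeneous_zero _ _ _
  have hphi : φ (X i * (P * g)) = (S : ℂ) := by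
    rw [show X i * (P * g) = g * (X i * P) by ring]
    simp only [g, Fp_apply, Finset.sum_mul, map_sum, hS, Complex.ofReal_sum]
    refine Finset.sum_congr rfl fun β _ => ?_
    have : (monomial β.1 ((starRingEnd ℂ) (c β)) : MvP d)
        = (starRingEnd ℂ) (c β) • monomial β.1 1 := by
      rw [smul_monomial, smul_eq_mul, mul_one]
    rw [this, smul_mul_assoc, map_smul, smul_eq_mul]
    by_cases h : β.1.degree = l
    · have h' : φ (monomial β.1 1 * (X i * P)) = c β := by simp only [hc, if_pos h]
      rw [h', mul_comm, Complex.mul_conj, Complex.normSq_eq_norm_sq]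
    · have h' : c β = 0 := by simp only [hc, if_neg h]
      simp [h']
  have hb := h1 i P g hP hg
  rw [hphi, Complex.norm_real, Real.norm_of_nonneg hS0] at hb
  have := norm2_nonneg P
  have := norm2_nonneg g
  rw [← hg2] at hb ⊢
  by_cases hz : norm2 g = 0
  · rw [hz, zero_pow two_ne_zero]; positivity
  · have hpos : 0 < norm2 g := lt_of_le_of_ne ‹_› (Ne.symm hz)
    have : norm2 g ≤ norm2 P := by
      rw [sq] at hb
      exact le_of_mul_le_mul_right hb hpos
    gcongr

include h0 h1 in
theorem TT_norm (i : Fin d) (v : HS d k l) : ‖TT φ i v‖ ≤ 1 * ‖v‖ := by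
  rw [one_mul]
  refine le_of_sq_le_sq ?_ (norm_nonneg _)
  rw [EuclideanSpace.norm_sq_eq, EuclideanSpace.norm_sq_eq, Fintype.sum_sum_type,
    Fintype.sum_sum_type]
  have e1 : ∑ α : Idx d k, ‖TT φ i v (Sum.inl α)‖ ^ 2
      ≤ norm2 (FF v - homogeneousComponent k (FF v)) ^ 2 := by
    rw [← norm2_X_mul i]
    refine le_trans (le_of_eq ?_) (sum_coeff_le _ (fun α : Idx d k => α.1) Subtype.val_injective)
    refine Finset.sum_congr rfl fun α _ => ?_
    rw [TT_inl, coeff_X_mul_congr (fun a ha => ?_) i α.1 α.2]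
    rw [coeff_sub, coeff_homogeneousComponent, if_neg ha.ne, sub_zero]
  have e2 : ∑ β : Idx d l, ‖TT φ i v (Sum.inr β)‖ ^ 2
      = ∑ β : Idx d l, ‖coeff (β.1 + Finsupp.single i 1) (GG v)‖ ^ 2 +
        ∑ β : Idx d l, ‖if β.1.degree = l then
          φ (monomial β.1 1 * (X i * homogeneousComponent k (FF v))) else 0‖ ^ 2 := by
    rw [← Finset.sum_add_distrib]
    refine Finset.sum_congr rfl fun β _ => ?_
    rw [TT_inr]
    split_ifs with h
    · rw [coeff_GG_of_gt _ _ (by rw [map_add, Finsupp.degree_single]; omega),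
        phi_hc φ h0 _ h]
      simp
    · simp
  have e3 := gamma_bound φ h1 i _ (homogeneousComponent_isHomogeneous k (FF v))
  have e4 := sum_coeff_le (GG v) (fun β : Idx d l => β.1 + Finsupp.single i 1)
    (fun a b h => Subtype.ext (add_right_cancel h))
  have e5 := norm2_split k (FF v)
  have e6 : norm2 (FF v) ^ 2 = ∑ α, ‖v (Sum.inl α)‖ ^ 2 := norm2_Fp _
  have e7 : norm2 (GG v) ^ 2 = ∑ α, ‖v (Sum.inr α)‖ ^ 2 := norm2_Fp _
  rw [e2]
  linarith

/-- The intertwiner. -/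
def JJ : MvP d →ₗ[ℂ] HS d k l where
  toFun q := WithLp.toLp 2 (Sum.elim (fun α => coeff α.1 q) (fun β => φ (monomial β.1 1 * q)))
  map_add' v w := by
    ext (α | β) <;> simp [mul_add]
  map_smul' c v := by
    ext (α | β) <;> simp

theorem JJ_inl (q : MvP d) (α : Idx d k) : JJ (l := l) φ q (Sum.inl α) = coeff α.1 q := rfl
theorem JJ_inr (q : MvP d) (β : Idx d l) :
    JJ (k := k) φ q (Sum.inr β) = φ (monomial β.1 1 * q) := rfl

theorem coeff_FF_JJ (q : MvP d) (α : Fin d →₀ ℕ) (h : α.degree ≤ k) :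
    coeff α (FF (JJ (k := k) (l := l) φ q)) = coeff α q := coeff_Fp _ ⟨α, h⟩

theorem coeff_GG_JJ (q : MvP d) (β : Fin d →₀ ℕ) (h : β.degree ≤ l) :
    coeff β (GG (JJ (k := k) (l := l) φ q)) = φ (monomial β 1 * q) := coeff_Fp _ ⟨β, h⟩

include h0 in
theorem TT_JJ (i : Fin d) (q : MvP d) :
    TT φ i (JJ (k := k) (l := l) φ q) = JJ φ (X i * q) := by
  ext (α | β)
  · rw [TT_inl, JJ_inl, coeff_X_mul_congr (fun a ha => coeff_FF_JJ φ q a ha.le) i α.1 α.2]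
  · obtain ⟨β, hβ⟩ := β
    have hd : (β + Finsupp.single i 1).degree = β.degree + 1 := by
      rw [map_add, Finsupp.degree_single]
    rw [TT_inr, JJ_inr]
    dsimp only
    rcases eq_or_lt_of_le hβ with h | h
    · rw [coeff_GG_of_gt _ _ (by omega), if_pos h, zero_add]
      exact phi_congr φ h0 β h i (coeff_FF_JJ φ q)
    · rw [coeff_GG_JJ _ _ _ (by omega), if_neg h.ne, add_zero, monomial_add_single']

include h0 in
theorem norm_JJ_one : ‖JJ (k := k) (l := l) φ 1‖ ≤ 1 := by
  have hz : (0 : Fin d →₀ ℕ).degree ≤ k := by simp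
  have : JJ (k := k) (l := l) φ 1 = EuclideanSpace.single (Sum.inl ⟨0, hz⟩) 1 := by
    classical
    ext (α | β)
    · rw [JJ_inl, coeff_one]
      simp only [PiLp.single_apply, Sum.inl.injEq, Subtype.ext_iff]
      simp [eq_comm]
    · rw [JJ_inr, mul_one]
      have hβ := β.2
      rw [h0 _ _ (isHomogeneous_monomial (1 : ℂ) rfl) (by omega)]
      simp
  rw [this]
  simp

theorem norm_phi_le (q : MvP d) : ‖φ q‖ ≤ ‖JJ (k := k) (l := l) φ q‖ := by
  have hz : (0 : Fin d →₀ ℕ).degree ≤ l := by simp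
  have h := PiLp.norm_apply_le (JJ (k := k) (l := l) φ q) (Sum.inr ⟨0, hz⟩)
  rw [JJ_inr] at h
  simpa using h

/-- The commuting tuple. -/
def XX (r : ℝ) (hr0 : 0 ≤ r) (hr : r < 1) : CTuple d where
  H := HS d k l
  T i := (r : ℂ) • (TT φ i).mkContinuous 1 (TT_norm φ h0 h1 i)
  comm i j := by
    ext1 v
    simp only [ContinuousLinearMap.comp_apply, _root_.smul_apply, map_smul,
      LinearMap.mkContinuous_apply]
    rw [TT_comm φ h0]
  strict i := by
    rw [norm_smul, Complex.norm_real, Real.norm_of_nonneg hr0]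
    have := LinearMap.mkContinuous_norm_le (TT φ i) zero_le_one (TT_norm φ h0 h1 i)
    nlinarith

theorem XX_T (r : ℝ) (hr0 : 0 ≤ r) (hr : r < 1) (i : Fin d) (q : MvP d) :
    (XX φ h0 h1 r hr0 hr).T i (JJ (k := k) (l := l) φ q) =
      JJ (k := k) (l := l) φ ((C (r : ℂ) * X i) * q) := by
  have : (C (r : ℂ) * X i) * q = (r : ℂ) • (X i * q) := by
    rw [smul_eq_C_mul, mul_assoc]
  rw [this, map_smul, ← TT_JJ φ h0]
  rfl

end model

theorem SA_bdd {d : ℕ} (p : MvP d) : BddAbove (Set.range fun X : CTuple d => ‖evalP p X‖) := by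
  refine ⟨∑ α ∈ p.support, ‖p.coeff α‖, ?_⟩
  rintro _ ⟨Y, rfl⟩
  refine (norm_sum_le _ _).trans (Finset.sum_le_sum fun α _ => ?_)
  rw [norm_smul]
  refine mul_le_of_le_one_right (norm_nonneg _) ?_
  rw [List.ofFn_eq_map]
  induction List.finRange d with
  | nil => simpa using norm_one_le' Y
  | cons a L ih =>
    rw [List.map_cons, List.prod_cons]
    refine (norm_mul_le _ _).trans (mul_le_one₀ ?_ (norm_nonneg _) ih)
    induction α a with
    | zero => simpa using norm_one_le' Y
    | succ m ihm =>
      rw [pow_succ]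
      exact (norm_mul_le _ _).trans (mul_le_one₀ ihm (norm_nonneg _) (Y.strict a).le)

theorem zwpNorm_le_SA {d k l : ℕ} {p : MvP d} (hp : p.IsHomogeneous (k + l + 1)) :
    zwpNorm d k l p ≤ SAnormP d p := by
  obtain ⟨φ, h0, h1, h2⟩ := exists_dual hp
  refine h2.trans ?_
  have key : ∀ r : ℝ, 0 ≤ r → r < 1 → r ^ (k + l + 1) * ‖φ p‖ ≤ SAnormP d p := by
    intro r hr0 hr
    refine le_trans ?_ (le_ciSup (SA_bdd p) (XX φ h0 h1 r hr0 hr))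
    refine le_trans ?_ (gen_bound (XX φ h0 h1 r hr0 hr) (JJ (k := k) (l := l) φ) r hr0
      (fun i q => XX_T φ h0 h1 r hr0 hr i q) (norm_JJ_one φ h0) p hp)
    exact mul_le_mul_of_nonneg_left (norm_phi_le φ p) (by positivity)
  have ht : Filter.Tendsto (fun r : ℝ => r ^ (k + l + 1) * ‖φ p‖) (nhdsWithin 1 (Set.Iio 1))
      (nhds (1 ^ (k + l + 1) * ‖φ p‖)) :=
    ((Continuous.tendsto (by fun_prop) 1).mono_left nhdsWithin_le_nhds)
  rw [one_pow, one_mul] at ht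
  refine le_of_tendsto ht ?_
  filter_upwards [Ioo_mem_nhdsLT (zero_lt_one (α := ℝ))] with r hr
  exact key r hr.1.le hr.2

/-- Theorem 1.4 / Theorem 5.6: weak product lower bounds for the Schur--Agler norm:
`‖p‖_SA ≥ |||p|||₂ ≥ |||p|||₁` for homogeneous `p` of degree `n ≥ 1`. -/
theorem schurAgler_ge_triple2_ge_triple1 (d n : ℕ) (hd : 1 ≤ d) (hn : 1 ≤ n) (p : MvP d)
    (hp : p.IsHomogeneous n) :
    triple2 d n p ≤ SAnormP d p ∧ triple1 d n p ≤ triple2 d n p := by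
  refine ⟨?_, triple1_le_triple2 hn hp⟩
  have : Nonempty (Fin n) := ⟨⟨0, hn⟩⟩
  refine ciSup_le fun k => ?_
  obtain ⟨k, hk⟩ := k
  obtain ⟨l, rfl⟩ : ∃ l, n = k + l + 1 := ⟨n - 1 - k, by omega⟩
  have := zwpNorm_le_SA hp
  simpa [show k + l - k = l by omega] using this
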